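/- arXiv:2112.06601 — 10 statements merged into one kernel-verified Lean document; each statement's English description precedes it below -/
import Mathlib

section
/- Let w, θ : ℝ² → ℝ be smooth functions satisfying the Bäcklund system (BT). Define I₁(x) = ∫₀ˣ cosh w(t,0) sin θ(t,0) dt, I₂(x,y) = ∫₀ʸ sinh w(x,s) cos θ(x,s) ds, I₃(x) = ∫₀ˣ e^{2I₁(t)} cosh w(t,0) cos θ(t,0) dt, and I₄(x,y) = e^{2I₁(x)} ∫₀ʸ e^{2I₂(x,s)} sinh w(x,s) sin θ(x,s) ds. Given S₀ > 0 and R₀ ∈ ℝ, set S(x,y) = S₀ e^{2(I₁(x)+I₂(x,y))} and R(x,y) = R₀ + 2S₀ (I₃(x) − I₄(x,y)). Then u = R + iS is a harmonic map to the hyperbolic upper half-plane corresponding to w, i.e. ∂_z̄ u = e^{−2w} ∂_z u and ∂_z u · ∂_z ū = S² at every point of ℝ². -/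
open Real intervalIntegral

noncomputable section

/-- Partial derivative in the first variable of a real-valued function on ℝ². -/
def pdx (f : ℝ → ℝ → ℝ) (x y : ℝ) : ℝ := deriv (fun t => f t y) x

/-- Partial derivative in the second variable of a real-valued function on ℝ². -/
def pdy (f : ℝ → ℝ → ℝ) (x y : ℝ) : ℝ := deriv (fun t => f x t) y

/-- Partial derivative in the first variable of a complex-valued function on ℝ². -/
def cdx (f : ℝ → ℝ → ℂ) (x y : ℝ) : ℂ := deriv (fun t => f t y) x

/-- Partial derivative in the second variable of a complex-valued function on ℝ². -/
def cdy (f : ℝ → ℝ → ℂ) (x y : ℝ) : ℂ := deriv (fun t => f x t) y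

/-- Wirtinger derivative ∂_z u = (1/2)(∂ₓu − i ∂_y u). -/
def dz (f : ℝ → ℝ → ℂ) (x y : ℝ) : ℂ := (1/2) * (cdx f x y - Complex.I * cdy f x y)

/-- Wirtinger derivative ∂_z̄ u = (1/2)(∂ₓu + i ∂_y u). -/
def dzbar (f : ℝ → ℝ → ℂ) (x y : ℝ) : ℂ := (1/2) * (cdx f x y + Complex.I * cdy f x y)

theorem aux_param (Q D : ℝ → ℝ → ℝ) (hQ : Continuous (Function.uncurry Q))
    (hD : Continuous (Function.uncurry D))
    (hQx : ∀ x y, HasDerivAt (fun t => Q t y) (D x y) x) (x y : ℝ) :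
    HasDerivAt (fun t => ∫ s in (0:ℝ)..y, Q t s) (∫ s in (0:ℝ)..y, D x s) x := by
  have hK : IsCompact (Metric.closedBall x 1 ×ˢ Set.uIcc 0 y) :=
    (isCompact_closedBall x 1).prod isCompact_uIcc
  obtain ⟨C, hC⟩ := hK.exists_bound_of_continuousOn hD.continuousOn
  have hQ1 : ∀ t, Continuous (Q t) := fun t => hQ.comp (by fun_prop : Continuous fun s => (t, s))
  have hD1 : ∀ t, Continuous (D t) := fun t => hD.comp (by fun_prop : Continuous fun s => (t, s))
  refine (intervalIntegral.hasDerivAt_integral_of_dominated_loc_of_deriv_le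
    (F := Q) (F' := D) (bound := fun _ => C)
    (Metric.closedBall_mem_nhds x one_pos) ?_ ?_ ?_ ?_ ?_ ?_).2
  · exact Filter.Eventually.of_forall fun t => (hQ1 t).aestronglyMeasurable
  · exact (hQ1 x).intervalIntegrable _ _
  · exact (hD1 x).aestronglyMeasurable
  · exact Filter.Eventually.of_forall fun t ht z hz =>
      hC (z, t) ⟨hz, Set.uIoc_subset_uIcc ht⟩
  · exact intervalIntegrable_const
  · exact Filter.Eventually.of_forall fun t ht z hz => hQx z t

theorem aux_prim (P Q D F : ℝ → ℝ → ℝ) (hP : Continuous (Function.uncurry P))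
    (hQ : Continuous (Function.uncurry Q))
    (hD : Continuous (Function.uncurry D))
    (hPy : ∀ x y, HasDerivAt (fun t => P x t) (D x y) y)
    (hQx : ∀ x y, HasDerivAt (fun t => Q t y) (D x y) x)
    (hF : ∀ x y, F x y = (∫ t in (0:ℝ)..x, P t 0) + ∫ s in (0:ℝ)..y, Q x s) :
    Continuous (Function.uncurry F) ∧
    (∀ x y, HasDerivAt (fun t => F t y) (P x y) x) ∧
    (∀ x y, HasDerivAt (fun t => F x t) (Q x y) y) := by
  have hF' : F = fun x y => (∫ t in (0:ℝ)..x, P t 0) + ∫ s in (0:ℝ)..y, Q x s := by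
    funext x y; exact hF x y
  subst hF'
  have hP0 : Continuous fun t => P t 0 := hP.comp (by fun_prop : Continuous fun t : ℝ => (t, (0:ℝ)))
  have hQ1 : ∀ t, Continuous (Q t) := fun t => hQ.comp (by fun_prop : Continuous fun s => (t, s))
  have hD1 : ∀ t, Continuous (D t) := fun t => hD.comp (by fun_prop : Continuous fun s => (t, s))
  refine ⟨?_, fun x y => ?_, fun x y => ?_⟩
  · have h1 : Continuous fun x => ∫ t in (0:ℝ)..x, P t 0 :=
      intervalIntegral.continuous_primitive (fun a b => hP0.intervalIntegrable a b) 0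
    have h2 : Continuous fun p : ℝ × ℝ => ∫ s in (0:ℝ)..p.2, Q p.1 s :=
      intervalIntegral.continuous_parametric_primitive_of_continuous hQ
    exact (h1.comp continuous_fst).add h2
  · have h1 : HasDerivAt (fun x => ∫ t in (0:ℝ)..x, P t 0) (P x 0) x :=
      (hP0.integral_hasStrictDerivAt 0 x).hasDerivAt
    have h2 := aux_param Q D hQ hD hQx x y
    have h3 : ∫ s in (0:ℝ)..y, D x s = P x y - P x 0 :=
      intervalIntegral.integral_eq_sub_of_hasDerivAt (fun s _ => hPy x s)
        ((hD1 x).intervalIntegrable _ _)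
    rw [h3] at h2
    exact (h1.add h2).congr_deriv (by ring)
  · have h1 : HasDerivAt (fun y => ∫ s in (0:ℝ)..y, Q x s) (Q x y) y :=
      ((hQ1 x).integral_hasStrictDerivAt 0 y).hasDerivAt
    exact h1.const_add _

theorem aux_partial (w : ℝ → ℝ → ℝ) (hw : ContDiff ℝ (⊤ : ℕ∞) (Function.uncurry w)) :
    Continuous (Function.uncurry (pdx w)) ∧ Continuous (Function.uncurry (pdy w)) ∧
    (∀ x y, HasDerivAt (fun t => w t y) (pdx w x y) x) ∧
    (∀ x y, HasDerivAt (fun t => w x t) (pdy w x y) y) := by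
  have hd : Differentiable ℝ (Function.uncurry w) := hw.differentiable (by simp)
  have hc : Continuous (fderiv ℝ (Function.uncurry w)) := hw.continuous_fderiv (by simp)
  have h1 : ∀ x y, HasDerivAt (fun t => w t y) (fderiv ℝ (Function.uncurry w) (x, y) (1, 0)) x := by
    intro x y
    exact (hd (x, y)).hasFDerivAt.comp_hasDerivAt x
      ((hasDerivAt_id x).prodMk (hasDerivAt_const x y))
  have h2 : ∀ x y, HasDerivAt (fun t => w x t) (fderiv ℝ (Function.uncurry w) (x, y) (0, 1)) y := by
    intro x y
    exact (hd (x, y)).hasFDerivAt.comp_hasDerivAt y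
      ((hasDerivAt_const y x).prodMk (hasDerivAt_id y))
  have e1 : Function.uncurry (pdx w) = fun p => fderiv ℝ (Function.uncurry w) p (1, 0) := by
    funext ⟨x, y⟩; exact (h1 x y).deriv
  have e2 : Function.uncurry (pdy w) = fun p => fderiv ℝ (Function.uncurry w) p (0, 1) := by
    funext ⟨x, y⟩; exact (h2 x y).deriv
  refine ⟨?_, ?_, fun x y => ?_, fun x y => ?_⟩
  · rw [e1]; fun_prop
  · rw [e2]; fun_prop
  · exact (h1 x y).differentiableAt.hasDerivAt
  · exact (h2 x y).differentiableAt.hasDerivAt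

theorem stmt_0
    (w θ : ℝ → ℝ → ℝ)
    (hw : ContDiff ℝ (⊤ : ℕ∞) (Function.uncurry w)) (hθ : ContDiff ℝ (⊤ : ℕ∞) (Function.uncurry θ))
    (hBT1 : ∀ x y, pdx w x y - pdy θ x y = -2 * Real.sinh (w x y) * Real.sin (θ x y))
    (hBT2 : ∀ x y, pdy w x y + pdx θ x y = -2 * Real.cosh (w x y) * Real.cos (θ x y))
    (I₁ : ℝ → ℝ) (hI₁ : ∀ x, I₁ x = ∫ t in (0:ℝ)..x, Real.cosh (w t 0) * Real.sin (θ t 0))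
    (I₂ : ℝ → ℝ → ℝ)
    (hI₂ : ∀ x y, I₂ x y = ∫ s in (0:ℝ)..y, Real.sinh (w x s) * Real.cos (θ x s))
    (I₃ : ℝ → ℝ)
    (hI₃ : ∀ x, I₃ x = ∫ t in (0:ℝ)..x,
      Real.exp (2 * I₁ t) * Real.cosh (w t 0) * Real.cos (θ t 0))
    (I₄ : ℝ → ℝ → ℝ)
    (hI₄ : ∀ x y, I₄ x y = Real.exp (2 * I₁ x) *
      ∫ s in (0:ℝ)..y, Real.exp (2 * I₂ x s) * Real.sinh (w x s) * Real.sin (θ x s))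
    (S₀ R₀ : ℝ) (hS₀ : 0 < S₀)
    (S R : ℝ → ℝ → ℝ)
    (hS : ∀ x y, S x y = S₀ * Real.exp (2 * (I₁ x + I₂ x y)))
    (hR : ∀ x y, R x y = R₀ + 2 * S₀ * (I₃ x - I₄ x y))
    (u : ℝ → ℝ → ℂ)
    (hu : ∀ x y, u x y = (R x y : ℂ) + Complex.I * (S x y : ℂ)) :
    ∀ x y, dzbar u x y = (Real.exp (-2 * w x y) : ℂ) * dz u x y ∧
      dz u x y * dz (fun a b => (starRingEnd ℂ) (u a b)) x y = ((S x y : ℂ))^2 := by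
  obtain ⟨cwx, cwy, dwx, dwy⟩ := aux_partial w hw
  obtain ⟨cθx, cθy, dθx, dθy⟩ := aux_partial θ hθ
  have cw := hw.continuous
  have cθ := hθ.continuous
  -- first potential
  obtain ⟨cF, dFx, dFy⟩ := aux_prim
    (fun x y => Real.cosh (w x y) * Real.sin (θ x y))
    (fun x y => Real.sinh (w x y) * Real.cos (θ x y))
    (fun x y => Real.sinh (w x y) * pdy w x y * Real.sin (θ x y)
      + Real.cosh (w x y) * (Real.cos (θ x y) * pdy θ x y))
    (fun x y => I₁ x + I₂ x y)
    (by simp only [Function.uncurry_def] at *; fun_prop)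
    (by simp only [Function.uncurry_def] at *; fun_prop)
    (by simp only [Function.uncurry_def] at *; fun_prop)
    (fun x y => (dwy x y).cosh.mul (dθy x y).sin)
    (fun x y => by
      refine ((dwx x y).sinh.mul (dθx x y).cos).congr_deriv ?_
      linear_combination (Real.cosh (w x y) * Real.cos (θ x y)) * hBT1 x y
        - (Real.sinh (w x y) * Real.sin (θ x y)) * hBT2 x y)
    (fun x y => by rw [hI₁, hI₂])
  have hSe : S = fun x y => S₀ * Real.exp (2 * (I₁ x + I₂ x y)) := by
    funext x y; exact hS x y
  have cS : Continuous (Function.uncurry S) := by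
    rw [hSe]
    simp only [Function.uncurry_def] at *
    fun_prop
  have dSx : ∀ x y, HasDerivAt (fun t => S t y)
      (2 * S x y * Real.cosh (w x y) * Real.sin (θ x y)) x := by
    intro x y
    rw [hSe]
    refine (((dFx x y).const_mul 2).exp.const_mul S₀).congr_deriv ?_
    ring
  have dSy : ∀ x y, HasDerivAt (fun t => S x t)
      (2 * S x y * Real.sinh (w x y) * Real.cos (θ x y)) y := by
    intro x y
    rw [hSe]
    refine (((dFy x y).const_mul 2).exp.const_mul S₀).congr_deriv ?_
    ring
  have I20 : ∀ x, I₂ x 0 = 0 := by intro x; rw [hI₂]; simp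
  -- second potential
  obtain ⟨cG, dGx, dGy⟩ := aux_prim
    (fun x y => 2 * (S x y * (Real.cosh (w x y) * Real.cos (θ x y))))
    (fun x y => -2 * (S x y * (Real.sinh (w x y) * Real.sin (θ x y))))
    (fun x y => 2 * (2 * S x y * Real.sinh (w x y) * Real.cos (θ x y)
        * (Real.cosh (w x y) * Real.cos (θ x y))
      + S x y * (Real.sinh (w x y) * pdy w x y * Real.cos (θ x y)
      + Real.cosh (w x y) * (-Real.sin (θ x y) * pdy θ x y))))
    (fun x y => 2 * S₀ * (I₃ x - I₄ x y))
    (by simp only [Function.uncurry_def] at *; fun_prop)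
    (by simp only [Function.uncurry_def] at *; fun_prop)
    (by simp only [Function.uncurry_def] at *; fun_prop)
    (fun x y => ((dSy x y).mul ((dwy x y).cosh.mul (dθy x y).cos)).const_mul 2)
    (fun x y => by
      refine (((dSx x y).mul ((dwx x y).sinh.mul (dθx x y).sin)).const_mul (-2)).congr_deriv ?_
      simp only [Pi.mul_apply]
      linear_combination (-2 * S x y * Real.cosh (w x y) * Real.sin (θ x y)) * hBT1 x y
        - (2 * S x y * Real.sinh (w x y) * Real.cos (θ x y)) * hBT2 x y)
    (fun x y => by
      rw [hI₃, hI₄, mul_sub, ← intervalIntegral.integral_const_mul,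
        ← intervalIntegral.integral_const_mul, ← intervalIntegral.integral_const_mul, sub_eq_add_neg,
        ← intervalIntegral.integral_neg]
      congr 1
      · congr 1
        funext t
        rw [hS, I20, add_zero]; ring
      · congr 1
        funext t
        rw [hS, mul_add, Real.exp_add]; ring)
  have dRx : ∀ x y, HasDerivAt (fun t => R t y)
      (2 * (S x y * (Real.cosh (w x y) * Real.cos (θ x y)))) x := by
    intro x y
    simp only [hR]
    exact (dGx x y).const_add R₀
  have dRy : ∀ x y, HasDerivAt (fun t => R x t)
      (-2 * (S x y * (Real.sinh (w x y) * Real.sin (θ x y)))) y := by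
    intro x y
    simp only [hR]
    exact (dGy x y).const_add R₀
  intro x y
  have ux : cdx u x y =
      ((2 * (S x y * (Real.cosh (w x y) * Real.cos (θ x y))) : ℝ) : ℂ)
        + Complex.I * ((2 * S x y * Real.cosh (w x y) * Real.sin (θ x y) : ℝ) : ℂ) := by
    unfold cdx
    simp only [hu]
    exact ((dRx x y).ofReal_comp.add ((dSx x y).ofReal_comp.const_mul Complex.I)).deriv
  have uy : cdy u x y =
      ((-2 * (S x y * (Real.sinh (w x y) * Real.sin (θ x y))) : ℝ) : ℂ)
        + Complex.I * ((2 * S x y * Real.sinh (w x y) * Real.cos (θ x y) : ℝ) : ℂ) := by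
    unfold cdy
    simp only [hu]
    exact ((dRy x y).ofReal_comp.add ((dSy x y).ofReal_comp.const_mul Complex.I)).deriv
  have vx : cdx (fun a b => (starRingEnd ℂ) (u a b)) x y =
      ((2 * (S x y * (Real.cosh (w x y) * Real.cos (θ x y))) : ℝ) : ℂ)
        + -Complex.I * ((2 * S x y * Real.cosh (w x y) * Real.sin (θ x y) : ℝ) : ℂ) := by
    unfold cdx
    simp only [hu, map_add, map_mul, Complex.conj_ofReal, Complex.conj_I]
    exact ((dRx x y).ofReal_comp.add ((dSx x y).ofReal_comp.const_mul (-Complex.I))).deriv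
  have vy : cdy (fun a b => (starRingEnd ℂ) (u a b)) x y =
      ((-2 * (S x y * (Real.sinh (w x y) * Real.sin (θ x y))) : ℝ) : ℂ)
        + -Complex.I * ((2 * S x y * Real.sinh (w x y) * Real.cos (θ x y) : ℝ) : ℂ) := by
    unfold cdy
    simp only [hu, map_add, map_mul, Complex.conj_ofReal, Complex.conj_I]
    exact ((dRy x y).ofReal_comp.add ((dSy x y).ofReal_comp.const_mul (-Complex.I))).deriv
  have hI := Complex.I_sq
  have hexp : Real.exp (-2 * w x y) * (Real.cosh (w x y) + Real.sinh (w x y))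
      = Real.cosh (w x y) - Real.sinh (w x y) := by
    rw [Real.cosh_add_sinh, Real.cosh_sub_sinh, ← Real.exp_add]; ring_nf
  have hch := Real.cosh_sq_sub_sinh_sq (w x y)
  have hsc := Real.sin_sq_add_cos_sq (θ x y)
  simp only [dz, dzbar, ux, uy, vx, vy]
  generalize Real.exp (-2 * w x y) = e at *
  generalize Real.cosh (w x y) = c at *
  generalize Real.sinh (w x y) = s at *
  generalize Real.sin (θ x y) = σ at *
  generalize Real.cos (θ x y) = κ at *
  generalize S x y = r at *
  have hexp' : (e:ℂ) * (c + s) = c - s := by exact_mod_cast hexp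
  have hch' : (c:ℂ)^2 - s^2 = 1 := by exact_mod_cast hch
  have hsc' : (σ:ℂ)^2 + κ^2 = 1 := by exact_mod_cast hsc
  push_cast
  have hz : (1/2 : ℂ) * (2 * (r * (c * κ)) + Complex.I * (2 * r * c * σ)
      - Complex.I * (-2 * (r * (s * σ)) + Complex.I * (2 * r * s * κ)))
      = r * (c + s) * (κ + Complex.I * σ) := by
    linear_combination (-(r * s * κ : ℂ)) * hI
  have hzb : (1/2 : ℂ) * (2 * (r * (c * κ)) + Complex.I * (2 * r * c * σ)
      + Complex.I * (-2 * (r * (s * σ)) + Complex.I * (2 * r * s * κ)))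
      = r * (c - s) * (κ + Complex.I * σ) := by
    linear_combination ((r * s * κ : ℂ)) * hI
  have hv : (1/2 : ℂ) * (2 * (r * (c * κ)) + -Complex.I * (2 * r * c * σ)
      - Complex.I * (-2 * (r * (s * σ)) + -Complex.I * (2 * r * s * κ)))
      = r * (c - s) * (κ - Complex.I * σ) := by
    linear_combination ((r * s * κ : ℂ)) * hI
  rw [hz, hzb, hv]
  constructor
  · linear_combination (-(r * (κ + Complex.I * σ)) : ℂ) * hexp'
  · linear_combination ((r:ℂ)^2 * (κ^2 + σ^2)) * hch' + (r:ℂ)^2 * hsc'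
      - ((r:ℂ)^2 * (c^2 - s^2) * σ^2) * hI

end
end

section
/- Let w, θ : ℝ² → ℝ be smooth functions satisfying the Bäcklund system (BT), and let R, S : ℝ² → ℝ be differentiable with S > 0 everywhere, satisfying ∂_x S = 2S cosh(w) sin(θ), ∂_y S = 2S sinh(w) cos(θ), ∂_x R = 2S cosh(w) cos(θ), ∂_y R = −2S sinh(w) sin(θ) at every point. Then u = R + iS is a harmonic map to the hyperbolic upper half-plane corresponding to w, i.e. ∂_z̄ u = e^{−2w} ∂_z u and ∂_z u · ∂_z ū = S² at every point of ℝ². -/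
open Real intervalIntegral

noncomputable section

theorem stmt_1
    (w θ : ℝ → ℝ → ℝ)
    (hw : ContDiff ℝ (⊤ : ℕ∞) (Function.uncurry w)) (hθ : ContDiff ℝ (⊤ : ℕ∞) (Function.uncurry θ))
    (hBT1 : ∀ x y, pdx w x y - pdy θ x y = -2 * Real.sinh (w x y) * Real.sin (θ x y))
    (hBT2 : ∀ x y, pdy w x y + pdx θ x y = -2 * Real.cosh (w x y) * Real.cos (θ x y))
    (R S : ℝ → ℝ → ℝ)
    (hRdiff : Differentiable ℝ (Function.uncurry R))
    (hSdiff : Differentiable ℝ (Function.uncurry S))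
    (hSpos : ∀ x y, 0 < S x y)
    (hSx : ∀ x y, pdx S x y = 2 * S x y * Real.cosh (w x y) * Real.sin (θ x y))
    (hSy : ∀ x y, pdy S x y = 2 * S x y * Real.sinh (w x y) * Real.cos (θ x y))
    (hRx : ∀ x y, pdx R x y = 2 * S x y * Real.cosh (w x y) * Real.cos (θ x y))
    (hRy : ∀ x y, pdy R x y = -2 * S x y * Real.sinh (w x y) * Real.sin (θ x y))
    (u : ℝ → ℝ → ℂ)
    (hu : ∀ x y, u x y = (R x y : ℂ) + Complex.I * (S x y : ℂ)) :
    ∀ x y, dzbar u x y = (Real.exp (-2 * w x y) : ℂ) * dz u x y ∧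
      dz u x y * dz (fun a b => (starRingEnd ℂ) (u a b)) x y = ((S x y : ℂ))^2 := by
  intro x y
  have hR1 : HasDerivAt (fun t => R t y) (pdx R x y) x := by
    have h : DifferentiableAt ℝ (fun t => Function.uncurry R (t, y)) x := by fun_prop
    exact h.hasDerivAt
  have hR2 : HasDerivAt (fun t => R x t) (pdy R x y) y := by
    have h : DifferentiableAt ℝ (fun t => Function.uncurry R (x, t)) y := by fun_prop
    exact h.hasDerivAt
  have hS1 : HasDerivAt (fun t => S t y) (pdx S x y) x := by
    have h : DifferentiableAt ℝ (fun t => Function.uncurry S (t, y)) x := by fun_prop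
    exact h.hasDerivAt
  have hS2 : HasDerivAt (fun t => S x t) (pdy S x y) y := by
    have h : DifferentiableAt ℝ (fun t => Function.uncurry S (x, t)) y := by fun_prop
    exact h.hasDerivAt
  have e1 : cdx u x y = (pdx R x y : ℂ) + Complex.I * (pdx S x y : ℂ) := by
    unfold cdx
    simp only [hu]
    exact (hR1.ofReal_comp.add (hS1.ofReal_comp.const_mul Complex.I)).deriv
  have e2 : cdy u x y = (pdy R x y : ℂ) + Complex.I * (pdy S x y : ℂ) := by
    unfold cdy
    simp only [hu]
    exact (hR2.ofReal_comp.add (hS2.ofReal_comp.const_mul Complex.I)).deriv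
  have e3 : cdx (fun a b => (starRingEnd ℂ) (u a b)) x y
      = (pdx R x y : ℂ) + (-Complex.I) * (pdx S x y : ℂ) := by
    unfold cdx
    simp only [hu, map_add, map_mul, Complex.conj_I, Complex.conj_ofReal]
    exact (hR1.ofReal_comp.add (hS1.ofReal_comp.const_mul (-Complex.I))).deriv
  have e4 : cdy (fun a b => (starRingEnd ℂ) (u a b)) x y
      = (pdy R x y : ℂ) + (-Complex.I) * (pdy S x y : ℂ) := by
    unfold cdy
    simp only [hu, map_add, map_mul, Complex.conj_I, Complex.conj_ofReal]
    exact (hR2.ofReal_comp.add (hS2.ofReal_comp.const_mul (-Complex.I))).deriv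
  have hexp : Real.exp (-2 * w x y) * (Real.cosh (w x y) + Real.sinh (w x y))
      = Real.cosh (w x y) - Real.sinh (w x y) := by
    rw [Real.cosh_add_sinh, Real.cosh_sub_sinh, ← Real.exp_add]
    congr 1
    ring
  have hch : Real.cosh (w x y) ^ 2 - Real.sinh (w x y) ^ 2 = 1 := Real.cosh_sq_sub_sinh_sq _
  have hcs : Real.sin (θ x y) ^ 2 + Real.cos (θ x y) ^ 2 = 1 := Real.sin_sq_add_cos_sq _
  have hI : Complex.I ^ 2 = -1 := Complex.I_sq
  rw [hSx, hRx] at e1 e3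
  rw [hSy, hRy] at e2 e4
  unfold dz dzbar
  rw [e1, e2, e3, e4]
  generalize Real.exp (-2 * w x y) = E at *
  generalize Real.cosh (w x y) = C at *
  generalize Real.sinh (w x y) = H at *
  generalize Real.sin (θ x y) = s at *
  generalize Real.cos (θ x y) = c at *
  generalize S x y = σ at *
  have hexp' : (E : ℂ) * (C + H) = C - H := by exact_mod_cast hexp
  have hch' : (C : ℂ) ^ 2 - H ^ 2 = 1 := by exact_mod_cast hch
  have hcs' : (s : ℂ) ^ 2 + c ^ 2 = 1 := by exact_mod_cast hcs
  push_cast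
  have d1 : (1 / 2 : ℂ) * (2 * σ * C * c + Complex.I * (2 * σ * C * s)
      - Complex.I * (-2 * σ * H * s + Complex.I * (2 * σ * H * c)))
      = σ * (C + H) * (c + Complex.I * s) := by
    linear_combination (-(σ * H * c : ℂ)) * hI
  have d2 : (1 / 2 : ℂ) * (2 * σ * C * c + Complex.I * (2 * σ * C * s)
      + Complex.I * (-2 * σ * H * s + Complex.I * (2 * σ * H * c)))
      = σ * (C - H) * (c + Complex.I * s) := by
    linear_combination ((σ * H * c : ℂ)) * hI
  have d3 : (1 / 2 : ℂ) * (2 * σ * C * c + -Complex.I * (2 * σ * C * s)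
      - Complex.I * (-2 * σ * H * s + -Complex.I * (2 * σ * H * c)))
      = σ * (C - H) * (c - Complex.I * s) := by
    linear_combination ((σ * H * c : ℂ)) * hI
  rw [d1, d2, d3]
  constructor
  · linear_combination (-(σ * (c + Complex.I * s) : ℂ)) * hexp'
  · linear_combination (σ ^ 2 * (c ^ 2 + s ^ 2) : ℂ) * hch' + (σ ^ 2 : ℂ) * hcs'
      - (σ ^ 2 * (C ^ 2 - H ^ 2) * s ^ 2 : ℂ) * hI

end
end

section
/- Define R(x,y) = x/2 + y² tanh(2x) and S(x,y) = y²/cosh(2x) − cosh(2x)/4, and let u = R + iS : ℝ² → ℂ. Then for all (x,y) ∈ ℝ²: ∂_z u · ∂_z ū = S(x,y)² and (cosh(2x) + 2y)² · ∂_z̄ u = (cosh(2x) − 2y)² · ∂_z u. In particular, wherever |2y| < cosh(2x), u is a harmonic map to the hyperbolic plane corresponding to the function w determined by tanh(w/2) = 2y/cosh(2x), since there e^{−2w} = ((cosh(2x) − 2y)/(cosh(2x) + 2y))². -/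
open Real intervalIntegral

noncomputable section

theorem aux_deriv (f g : ℝ → ℝ) (a b x : ℝ) (hf : HasDerivAt f a x) (hg : HasDerivAt g b x) :
    deriv (fun t => (f t : ℂ) + Complex.I * (g t : ℂ)) x = (a : ℂ) + Complex.I * (b : ℂ) ∧
    deriv (fun t => (f t : ℂ) - Complex.I * (g t : ℂ)) x = (a : ℂ) - Complex.I * (b : ℂ) :=
  ⟨(hf.ofReal_comp.add (hg.ofReal_comp.const_mul Complex.I)).deriv,
   (hf.ofReal_comp.sub (hg.ofReal_comp.const_mul Complex.I)).deriv⟩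

theorem stmt_11
    (R S : ℝ → ℝ → ℝ) (u : ℝ → ℝ → ℂ)
    (hR : ∀ x y, R x y = x / 2 + y ^ 2 * Real.tanh (2 * x))
    (hS : ∀ x y, S x y = y ^ 2 / Real.cosh (2 * x) - Real.cosh (2 * x) / 4)
    (hu : ∀ x y, u x y = (R x y : ℂ) + Complex.I * (S x y : ℂ)) :
    ∀ x y,
      dz u x y * dz (fun p q => (starRingEnd ℂ) (u p q)) x y = ((S x y : ℂ)) ^ 2 ∧
      ((Real.cosh (2 * x) + 2 * y : ℝ) : ℂ) ^ 2 * dzbar u x y =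
        ((Real.cosh (2 * x) - 2 * y : ℝ) : ℂ) ^ 2 * dz u x y ∧
      (|2 * y| < Real.cosh (2 * x) →
        ∀ w : ℝ, Real.tanh (w / 2) = 2 * y / Real.cosh (2 * x) →
          Real.exp (-2 * w) =
            ((Real.cosh (2 * x) - 2 * y) / (Real.cosh (2 * x) + 2 * y)) ^ 2 ∧
          dzbar u x y = (Real.exp (-2 * w) : ℂ) * dz u x y) := by
  intro x y
  have hc : 0 < Real.cosh (2 * x) := Real.cosh_pos _
  have hsq : Real.cosh (2 * x) ^ 2 = Real.sinh (2 * x) ^ 2 + 1 := Real.cosh_sq _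
  have h2 : HasDerivAt (fun t : ℝ => 2 * t) 2 x := by
    simpa using (hasDerivAt_id x).const_mul (2 : ℝ)
  have hC : HasDerivAt (fun t : ℝ => Real.cosh (2 * t)) (Real.sinh (2 * x) * 2) x := h2.cosh
  have hSi : HasDerivAt (fun t : ℝ => Real.sinh (2 * t)) (Real.cosh (2 * x) * 2) x := h2.sinh
  have hy2 : HasDerivAt (fun t : ℝ => t ^ 2) (2 * y) y := by
    simpa using hasDerivAt_pow 2 y
  have hRx : HasDerivAt (fun t => R t y) (1 / 2 + 2 * y ^ 2 / Real.cosh (2 * x) ^ 2) x := by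
    have e : (fun t => R t y)
        = fun t => t / 2 + y ^ 2 * (Real.sinh (2 * t) / Real.cosh (2 * t)) := by
      funext t; rw [hR, Real.tanh_eq_sinh_div_cosh]
    rw [e]
    refine (((hasDerivAt_id x).div_const 2).add
      ((hSi.div hC hc.ne').const_mul (y ^ 2))).congr_deriv ?_
    field_simp
    linear_combination (4 * y ^ 2) * hsq
  have hRy : HasDerivAt (fun t => R x t) (2 * y * Real.sinh (2 * x) / Real.cosh (2 * x)) y := by
    have e : (fun t => R x t)
        = fun t => x / 2 + t ^ 2 * (Real.sinh (2 * x) / Real.cosh (2 * x)) := by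
      funext t; rw [hR, Real.tanh_eq_sinh_div_cosh]
    rw [e]
    refine ((hy2.mul_const _).const_add _).congr_deriv ?_
    ring
  have hSx : HasDerivAt (fun t => S t y)
      (-Real.sinh (2 * x) * (1 / 2 + 2 * y ^ 2 / Real.cosh (2 * x) ^ 2)) x := by
    have e : (fun t => S t y)
        = fun t => y ^ 2 / Real.cosh (2 * t) - Real.cosh (2 * t) / 4 := by
      funext t; rw [hS]
    rw [e]
    refine (((hasDerivAt_const x (y ^ 2)).div hC hc.ne').sub (hC.div_const 4)).congr_deriv ?_
    field_simp
    ring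
  have hSy : HasDerivAt (fun t => S x t) (2 * y / Real.cosh (2 * x)) y := by
    have e : (fun t => S x t)
        = fun t => t ^ 2 / Real.cosh (2 * x) - Real.cosh (2 * x) / 4 := by
      funext t; rw [hS]
    rw [e]
    exact (hy2.div_const _).sub_const _
  have hx := aux_deriv _ _ _ _ _ hRx hSx
  have hy := aux_deriv _ _ _ _ _ hRy hSy
  have hbar : (fun p q => (starRingEnd ℂ) (u p q))
      = fun p q => (R p q : ℂ) - Complex.I * (S p q : ℂ) := by
    funext p q
    rw [hu]; simp [sub_eq_add_neg]
  have hu' : u = fun p q => (R p q : ℂ) + Complex.I * (S p q : ℂ) := by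
    funext p q; exact hu p q
  have hcC : (Real.cosh (2 * x) : ℂ) ≠ 0 := by exact_mod_cast hc.ne'
  have hsqC : (Real.cosh (2 * x) : ℂ) ^ 2 = (Real.sinh (2 * x) : ℂ) ^ 2 + 1 := by
    exact_mod_cast hsq
  have hz : dz u x y = (1 - Complex.I * (Real.sinh (2 * x) : ℂ)) *
      ((Real.cosh (2 * x) : ℂ) + 2 * y) ^ 2 / (4 * (Real.cosh (2 * x) : ℂ) ^ 2) := by
    simp only [dz, cdx, cdy, hu']
    rw [hx.1, hy.1]
    push_cast [-Complex.ofReal_cosh, -Complex.ofReal_sinh]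
    generalize (Real.cosh (2 * x) : ℂ) = c at *
    generalize (Real.sinh (2 * x) : ℂ) = s at *
    field_simp
    ring_nf
    simp only [Complex.I_sq]
    ring
  have hzb : dzbar u x y = (1 - Complex.I * (Real.sinh (2 * x) : ℂ)) *
      ((Real.cosh (2 * x) : ℂ) - 2 * y) ^ 2 / (4 * (Real.cosh (2 * x) : ℂ) ^ 2) := by
    simp only [dzbar, cdx, cdy, hu']
    rw [hx.1, hy.1]
    push_cast [-Complex.ofReal_cosh, -Complex.ofReal_sinh]
    generalize (Real.cosh (2 * x) : ℂ) = c at *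
    generalize (Real.sinh (2 * x) : ℂ) = s at *
    field_simp
    ring_nf
    simp only [Complex.I_sq]
    ring
  have hzc : dz (fun p q => (starRingEnd ℂ) (u p q)) x y
      = (1 + Complex.I * (Real.sinh (2 * x) : ℂ)) *
      ((Real.cosh (2 * x) : ℂ) - 2 * y) ^ 2 / (4 * (Real.cosh (2 * x) : ℂ) ^ 2) := by
    rw [hbar]
    simp only [dz, cdx, cdy]
    rw [hx.2, hy.2]
    push_cast [-Complex.ofReal_cosh, -Complex.ofReal_sinh]
    generalize (Real.cosh (2 * x) : ℂ) = c at *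
    generalize (Real.sinh (2 * x) : ℂ) = s at *
    field_simp
    ring_nf
    simp only [Complex.I_sq]
    ring
  refine ⟨?_, ?_, ?_⟩
  · rw [hz, hzc, hS]
    push_cast [-Complex.ofReal_cosh, -Complex.ofReal_sinh]
    generalize (Real.cosh (2 * x) : ℂ) = c at *
    generalize (Real.sinh (2 * x) : ℂ) = s at *
    have h1 : (1 - Complex.I * s) * (1 + Complex.I * s) = c ^ 2 := by
      linear_combination -hsqC - s ^ 2 * Complex.I_sq
    have h3 : (1 - Complex.I * s) * (c + 2 * y) ^ 2 / (4 * c ^ 2) *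
        ((1 + Complex.I * s) * (c - 2 * y) ^ 2 / (4 * c ^ 2))
        = ((1 - Complex.I * s) * (1 + Complex.I * s)) * ((c + 2 * y) ^ 2 * (c - 2 * y) ^ 2)
          / (16 * c ^ 4) := by
      field_simp
      ring
    rw [h3, h1]
    field_simp
    ring
  · rw [hz, hzb]
    push_cast [-Complex.ofReal_cosh, -Complex.ofReal_sinh]
    ring
  · intro hlt w hw
    have hp : 0 < Real.cosh (2 * x) + 2 * y := by linarith [(abs_lt.mp hlt).1]
    have hexp : Real.exp (-2 * w) =
        ((Real.cosh (2 * x) - 2 * y) / (Real.cosh (2 * x) + 2 * y)) ^ 2 := by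
      have e1 : Real.exp (-2 * w) = Real.exp (-w) ^ 2 := by
        rw [← Real.exp_nat_mul]; congr 1; push_cast; ring
      rw [e1]
      congr 1
      rw [Real.tanh_eq_sinh_div_cosh, div_eq_div_iff (Real.cosh_pos _).ne' hc.ne',
        Real.sinh_eq, Real.cosh_eq (w / 2)] at hw
      rw [eq_div_iff hp.ne']
      have e2 : Real.exp (-(w / 2)) = Real.exp (-w) * Real.exp (w / 2) := by
        rw [← Real.exp_add]; congr 1; ring
      rw [e2] at hw
      apply mul_right_cancel₀ (Real.exp_pos (w / 2)).ne'
      linear_combination (-2) * hw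
    refine ⟨hexp, ?_⟩
    have hpC : (Real.cosh (2 * x) : ℂ) + 2 * y ≠ 0 := by exact_mod_cast hp.ne'
    have hexpC : (Real.exp (-2 * w) : ℂ) = (((Real.cosh (2 * x) : ℂ) - 2 * y) /
        ((Real.cosh (2 * x) : ℂ) + 2 * y)) ^ 2 := by
      exact_mod_cast congrArg (fun r : ℝ => (r : ℂ)) hexp
    rw [hexpC, hz, hzb]
    generalize (Real.cosh (2 * x) : ℂ) = c at *
    generalize (Real.sinh (2 * x) : ℂ) = s at *
    field_simp

end
end

section
/- Define D(x,y) = 1 + cosh(4√2 y) − 2 sin(4x), S(x,y) = e^{2x} (1 + 2 cos(4x) − cosh(4√2 y))/D(x,y), R(x,y) = −4 e^{2x} cos(2x) sinh(2√2 y)/D(x,y), and u = R + iS on the open set where D ≠ 0. Then at every point where D(x,y) ≠ 0: ∂_z u · ∂_z ū = S(x,y)² and (√2 cos(2x) + cosh(2√2 y))² · ∂_z̄ u = (√2 cos(2x) − cosh(2√2 y))² · ∂_z u. In particular, wherever moreover cosh(2√2 y) < √2 cos(2x), u is a harmonic map to the hyperbolic plane corresponding to the function w determined by tanh(w/2) =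 (√2/2) cosh(2√2 y)/cos(2x), since there e^{−2w} = ((√2 cos(2x) − cosh(2√2 y))/(√2 cos(2x) + cosh(2√2 y)))². -/
open Real intervalIntegral

noncomputable section

theorem aux_trig (x : ℝ) : Real.sin (4 * x) = 2 * Real.sin (2 * x) * Real.cos (2 * x) ∧
    Real.cos (4 * x) = 2 * Real.cos (2 * x) ^ 2 - 1 := by
  have h : 4 * x = 2 * (2 * x) := by ring
  rw [h, Real.sin_two_mul, Real.cos_two_mul (2 * x)]
  exact ⟨rfl, rfl⟩

theorem aux_hyp (y : ℝ) : Real.cosh (4 * Real.sqrt 2 * y) =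
    2 * Real.cosh (2 * Real.sqrt 2 * y) ^ 2 - 1 := by
  have h : 4 * Real.sqrt 2 * y = 2 * (2 * Real.sqrt 2 * y) := by ring
  rw [h, Real.cosh_two_mul, Real.sinh_sq]
  ring

theorem aux_dx (C H x : ℝ) (hN : C ^ 2 - 2 * Real.sin (2 * x) * Real.cos (2 * x) ≠ 0) :
    HasDerivAt (fun t => -2 * Real.exp (2 * t) * Real.cos (2 * t) * H /
      (C ^ 2 - 2 * Real.sin (2 * t) * Real.cos (2 * t)))
      (-4 * Real.exp (2 * x) * H * (Real.cos (2 * x) - Real.sin (2 * x)) *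
        (2 * Real.cos (2 * x) ^ 2 + C ^ 2) /
        (C ^ 2 - 2 * Real.sin (2 * x) * Real.cos (2 * x)) ^ 2) x ∧
    HasDerivAt (fun t => Real.exp (2 * t) * (2 * Real.cos (2 * t) ^ 2 - C ^ 2) /
      (C ^ 2 - 2 * Real.sin (2 * t) * Real.cos (2 * t)))
      (2 * Real.exp (2 * x) * (2 * Real.cos (2 * x) ^ 2 + C ^ 2) *
        (2 - C ^ 2 - 2 * Real.sin (2 * x) * Real.cos (2 * x)) /
        (C ^ 2 - 2 * Real.sin (2 * x) * Real.cos (2 * x)) ^ 2) x := by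
  have h2 : HasDerivAt (fun t : ℝ => 2 * t) 2 x := by
    simpa using (hasDerivAt_id x).const_mul 2
  have hE := h2.exp
  have hs := h2.sin
  have hc := h2.cos
  have hd := ((hs.const_mul 2).mul hc).const_sub (C ^ 2)
  have hsc := Real.sin_sq_add_cos_sq (2 * x)
  constructor
  · have := (((hE.const_mul (-2)).mul hc).mul_const H).div hd hN
    refine this.congr_deriv ?_
    simp only [Pi.mul_apply]
    congr 1
    ring
  · have := (hE.mul (((hc.pow 2).const_mul 2).sub_const (C ^ 2))).div hd hN
    refine this.congr_deriv ?_
    simp only [Pi.mul_apply, Pi.pow_apply]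
    congr 1
    generalize Real.sin (2 * x) = s at *
    generalize Real.cos (2 * x) = c at *
    generalize Real.exp (2 * x) = E at *
    have h2' : (2 : ℝ) = 2 * (s ^ 2 + c ^ 2) := by rw [hsc]; ring
    have : 2 * E * (2 * c ^ 2 + C ^ 2) * (2 - C ^ 2 - 2 * s * c) =
      2 * E * (2 * c ^ 2 + C ^ 2) * (2 * (s ^ 2 + c ^ 2) - C ^ 2 - 2 * s * c) := by
      rw [hsc]; ring
    rw [this]
    push_cast
    ring

theorem aux_dy (E c s y : ℝ) (hN : Real.cosh (2 * Real.sqrt 2 * y) ^ 2 - 2 * s * c ≠ 0) :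
    HasDerivAt (fun t => -2 * E * c * Real.sinh (2 * Real.sqrt 2 * t) /
      (Real.cosh (2 * Real.sqrt 2 * t) ^ 2 - 2 * s * c))
      (-4 * Real.sqrt 2 * E * c * Real.cosh (2 * Real.sqrt 2 * y) *
        (2 - Real.cosh (2 * Real.sqrt 2 * y) ^ 2 - 2 * s * c) /
        (Real.cosh (2 * Real.sqrt 2 * y) ^ 2 - 2 * s * c) ^ 2) y ∧
    HasDerivAt (fun t => E * (2 * c ^ 2 - Real.cosh (2 * Real.sqrt 2 * t) ^ 2) /
      (Real.cosh (2 * Real.sqrt 2 * t) ^ 2 - 2 * s * c))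
      (-8 * Real.sqrt 2 * E * Real.cosh (2 * Real.sqrt 2 * y) *
        Real.sinh (2 * Real.sqrt 2 * y) * c * (c - s) /
        (Real.cosh (2 * Real.sqrt 2 * y) ^ 2 - 2 * s * c) ^ 2) y := by
  have h2 : HasDerivAt (fun t : ℝ => 2 * Real.sqrt 2 * t) (2 * Real.sqrt 2) y := by
    simpa using (hasDerivAt_id y).const_mul (2 * Real.sqrt 2)
  have hC := h2.cosh
  have hH := h2.sinh
  have hd := (hC.pow 2).sub_const (2 * s * c)
  have hq := Real.cosh_sq (2 * Real.sqrt 2 * y)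
  constructor
  · have := (hH.const_mul (-2 * E * c)).div hd hN
    refine this.congr_deriv ?_
    simp only [Pi.pow_apply]
    congr 1
    have hq' : Real.sinh (2 * Real.sqrt 2 * y) ^ 2 = Real.cosh (2 * Real.sqrt 2 * y) ^ 2 - 1 := by
      rw [hq]; ring
    push_cast
    linear_combination (8 * E * c * Real.cosh (2 * Real.sqrt 2 * y) * Real.sqrt 2) * hq'
  · have := (((hC.pow 2).const_sub (2 * c ^ 2)).const_mul E).div hd hN
    refine this.congr_deriv ?_
    simp only [Pi.pow_apply]
    congr 1
    push_cast
    ring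

theorem aux_cplx (f g : ℝ → ℝ) (f' g' x : ℝ) (hf : HasDerivAt f f' x) (hg : HasDerivAt g g' x) :
    deriv (fun t => (f t : ℂ) + Complex.I * (g t : ℂ)) x = (f' : ℂ) + Complex.I * (g' : ℂ) ∧
    deriv (fun t => (starRingEnd ℂ) ((f t : ℂ) + Complex.I * (g t : ℂ))) x
      = (f' : ℂ) - Complex.I * (g' : ℂ) := by
  refine ⟨(hf.ofReal_comp.add (hg.ofReal_comp.const_mul Complex.I)).deriv, ?_⟩
  have : (fun t => (starRingEnd ℂ) ((f t : ℂ) + Complex.I * (g t : ℂ))) =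
      fun t => (f t : ℂ) - Complex.I * (g t : ℂ) := by
    funext t
    simp [sub_eq_add_neg]
  rw [this]
  exact (hf.ofReal_comp.sub (hg.ofReal_comp.const_mul Complex.I)).deriv

theorem stmt_12
    (D R S : ℝ → ℝ → ℝ) (u : ℝ → ℝ → ℂ)
    (hD : ∀ x y, D x y = 1 + Real.cosh (4 * Real.sqrt 2 * y) - 2 * Real.sin (4 * x))
    (hS : ∀ x y, S x y = Real.exp (2 * x) *
      (1 + 2 * Real.cos (4 * x) - Real.cosh (4 * Real.sqrt 2 * y)) / D x y)
    (hR : ∀ x y, R x y = -4 * Real.exp (2 * x) * Real.cos (2 * x) *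
      Real.sinh (2 * Real.sqrt 2 * y) / D x y)
    (hu : ∀ x y, u x y = (R x y : ℂ) + Complex.I * (S x y : ℂ)) :
    ∀ x y, D x y ≠ 0 →
      dz u x y * dz (fun p q => (starRingEnd ℂ) (u p q)) x y = ((S x y : ℂ)) ^ 2 ∧
      ((Real.sqrt 2 * Real.cos (2 * x) + Real.cosh (2 * Real.sqrt 2 * y) : ℝ) : ℂ) ^ 2 *
          dzbar u x y =
        ((Real.sqrt 2 * Real.cos (2 * x) - Real.cosh (2 * Real.sqrt 2 * y) : ℝ) : ℂ) ^ 2 *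
          dz u x y ∧
      (Real.cosh (2 * Real.sqrt 2 * y) < Real.sqrt 2 * Real.cos (2 * x) →
        ∀ w : ℝ, Real.tanh (w / 2) =
            Real.sqrt 2 / 2 * Real.cosh (2 * Real.sqrt 2 * y) / Real.cos (2 * x) →
          Real.exp (-2 * w) =
            ((Real.sqrt 2 * Real.cos (2 * x) - Real.cosh (2 * Real.sqrt 2 * y)) /
              (Real.sqrt 2 * Real.cos (2 * x) + Real.cosh (2 * Real.sqrt 2 * y))) ^ 2 ∧
          dzbar u x y = (Real.exp (-2 * w) : ℂ) * dz u x y) := by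
  intro x y hD0
  have hD' : ∀ x y, D x y = 2 * (Real.cosh (2 * Real.sqrt 2 * y) ^ 2 -
      2 * Real.sin (2 * x) * Real.cos (2 * x)) := by
    intro x y
    rw [hD, aux_hyp, (aux_trig x).1]; ring
  have hS' : ∀ x y, S x y = Real.exp (2 * x) * (2 * Real.cos (2 * x) ^ 2 -
      Real.cosh (2 * Real.sqrt 2 * y) ^ 2) / (Real.cosh (2 * Real.sqrt 2 * y) ^ 2 -
      2 * Real.sin (2 * x) * Real.cos (2 * x)) := by
    intro x y
    rw [hS, hD', aux_hyp, (aux_trig x).2, ← mul_div_mul_left (Real.exp (2 * x) * (2 * Real.cos (2 * x) ^ 2 -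
      Real.cosh (2 * Real.sqrt 2 * y) ^ 2)) _ (two_ne_zero (α := ℝ))]
    congr 1
    ring
  have hR' : ∀ x y, R x y = -2 * Real.exp (2 * x) * Real.cos (2 * x) *
      Real.sinh (2 * Real.sqrt 2 * y) / (Real.cosh (2 * Real.sqrt 2 * y) ^ 2 -
      2 * Real.sin (2 * x) * Real.cos (2 * x)) := by
    intro x y
    rw [hR, hD', ← mul_div_mul_left (-2 * Real.exp (2 * x) * Real.cos (2 * x) *
      Real.sinh (2 * Real.sqrt 2 * y)) _ (two_ne_zero (α := ℝ))]
    congr 1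
    ring
  have hN : Real.cosh (2 * Real.sqrt 2 * y) ^ 2 - 2 * Real.sin (2 * x) * Real.cos (2 * x) ≠ 0 := by
    intro h
    apply hD0
    rw [hD', h, mul_zero]
  obtain ⟨hRx, hSx⟩ := aux_dx (Real.cosh (2 * Real.sqrt 2 * y)) (Real.sinh (2 * Real.sqrt 2 * y))
    x hN
  obtain ⟨hRy, hSy⟩ := aux_dy (Real.exp (2 * x)) (Real.cos (2 * x)) (Real.sin (2 * x)) y hN
  simp only [← hR', ← hS'] at hRx hSx hRy hSy
  obtain ⟨e1, e2⟩ := aux_cplx _ _ _ _ _ hRx hSx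
  obtain ⟨e3, e4⟩ := aux_cplx _ _ _ _ _ hRy hSy
  have hq2 : Real.sqrt 2 ^ 2 = 2 := Real.sq_sqrt (by norm_num)
  have hsc := Real.sin_sq_add_cos_sq (2 * x)
  have hCH := Real.cosh_sq (2 * Real.sqrt 2 * y)
  have hCpos := Real.cosh_pos (2 * Real.sqrt 2 * y)
  have hSv := hS' x y
  have key2 : ((Real.sqrt 2 * Real.cos (2 * x) + Real.cosh (2 * Real.sqrt 2 * y) : ℝ) : ℂ) ^ 2 *
          dzbar u x y =
        ((Real.sqrt 2 * Real.cos (2 * x) - Real.cosh (2 * Real.sqrt 2 * y) : ℝ) : ℂ) ^ 2 *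
          dz u x y := by
    simp only [dz, dzbar, cdx, cdy, hu]
    rw [e1, e3]
    clear hRx hSx hRy hSy e1 e2 e3 e4 hSv
    generalize Real.cosh (2 * Real.sqrt 2 * y) = C at *
    generalize Real.sinh (2 * Real.sqrt 2 * y) = H at *
    generalize Real.sqrt 2 = q at *
    generalize Real.cos (2 * x) = c at *
    generalize Real.sin (2 * x) = s at *
    generalize Real.exp (2 * x) = E at *
    generalize hn : C ^ 2 - 2 * s * c = N at *
    have hq2' : (q : ℂ) ^ 2 = 2 := by exact_mod_cast hq2
    have hq3' : (q : ℂ) ^ 3 = 2 * q := by rw [pow_succ, hq2']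
    have hN' : (N : ℂ) ≠ 0 := by exact_mod_cast hN
    push_cast
    field_simp
    ring_nf
    simp only [Complex.I_sq, hq2', hq3']
    ring_nf
  refine ⟨?_, key2, ?_⟩
  · simp only [dz, cdx, cdy, hu]
    rw [e1, e3, e2, e4, hSv]
    clear hRx hSx hRy hSy e1 e2 e3 e4 hSv key2
    generalize Real.cosh (2 * Real.sqrt 2 * y) = C at *
    generalize Real.sinh (2 * Real.sqrt 2 * y) = H at *
    generalize Real.sqrt 2 = q at *
    generalize Real.cos (2 * x) = c at *
    generalize Real.sin (2 * x) = s at *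
    generalize Real.exp (2 * x) = E at *
    have hNid : 4 * H ^ 2 * (c - s) ^ 2 + (2 - C ^ 2 - 2 * s * c) ^ 2 =
        (C ^ 2 - 2 * s * c) ^ 2 := by
      linear_combination (4 * H ^ 2) * hsc - 4 * (1 - 2 * s * c) * hCH
    generalize hn : C ^ 2 - 2 * s * c = N at *
    generalize hP : c - s = P at *
    generalize hT : 2 - C ^ 2 - 2 * s * c = T at *
    have r1 : (-4 * E * H * P * (2 * c ^ 2 + C ^ 2) / N ^ 2) ^ 2 +
        (2 * E * (2 * c ^ 2 + C ^ 2) * T / N ^ 2) ^ 2 -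
        (-4 * q * E * c * C * T / N ^ 2) ^ 2 - (-8 * q * E * C * H * c * P / N ^ 2) ^ 2 =
        4 * (E * (2 * c ^ 2 - C ^ 2) / N) ^ 2 := by
      have : (-4 * E * H * P * (2 * c ^ 2 + C ^ 2)) ^ 2 +
        (2 * E * (2 * c ^ 2 + C ^ 2) * T) ^ 2 -
        (-4 * q * E * c * C * T) ^ 2 - (-8 * q * E * C * H * c * P) ^ 2 =
        4 * (E * (2 * c ^ 2 - C ^ 2)) ^ 2 * N ^ 2 := by
        rw [← hNid]
        linear_combination (-16 * E ^ 2 * c ^ 2 * C ^ 2 * T ^ 2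
          - 64 * E ^ 2 * C ^ 2 * H ^ 2 * c ^ 2 * P ^ 2) * hq2
      simp only [div_pow]
      rw [← add_div, ← sub_div, ← sub_div, this]
      field_simp
    have r2 : (-4 * E * H * P * (2 * c ^ 2 + C ^ 2) / N ^ 2) * (-4 * q * E * c * C * T / N ^ 2) +
        (2 * E * (2 * c ^ 2 + C ^ 2) * T / N ^ 2) * (-8 * q * E * C * H * c * P / N ^ 2) = 0 := by
      ring
    generalize -4 * E * H * P * (2 * c ^ 2 + C ^ 2) / N ^ 2 = a at *
    generalize 2 * E * (2 * c ^ 2 + C ^ 2) * T / N ^ 2 = b at *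
    generalize -4 * q * E * c * C * T / N ^ 2 = a' at *
    generalize -8 * q * E * C * H * c * P / N ^ 2 = b' at *
    generalize E * (2 * c ^ 2 - C ^ 2) / N = σ at *
    have r1' : (a : ℂ) ^ 2 + (b : ℂ) ^ 2 - (a' : ℂ) ^ 2 - (b' : ℂ) ^ 2 = 4 * (σ : ℂ) ^ 2 := by
      exact_mod_cast r1
    have r2' : (a : ℂ) * a' + (b : ℂ) * b' = 0 := by exact_mod_cast r2
    have hI : Complex.I ^ 2 = -1 := Complex.I_sq
    linear_combination (1 / 4) * r1' - (Complex.I / 2) * r2' +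
      (1 / 4) * ((a' : ℂ) ^ 2 - (b : ℂ) ^ 2 + 2 * Complex.I * b * b' + (1 - Complex.I ^ 2) * (b' : ℂ) ^ 2) * hI
  · intro hlt w hw
    have hqc : 0 < Real.sqrt 2 * Real.cos (2 * x) := hCpos.trans hlt
    have hq0 : 0 < Real.sqrt 2 := by positivity
    have hc0 : 0 < Real.cos (2 * x) := (mul_pos_iff_of_pos_left hq0).1 hqc
    have hexp : Real.exp (-w) =
        (Real.sqrt 2 * Real.cos (2 * x) - Real.cosh (2 * Real.sqrt 2 * y)) /
        (Real.sqrt 2 * Real.cos (2 * x) + Real.cosh (2 * Real.sqrt 2 * y)) := by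
      rw [Real.tanh_eq_sinh_div_cosh, div_eq_div_iff (Real.cosh_pos _).ne' hc0.ne',
        Real.sinh_eq, Real.cosh_eq (w / 2)] at hw
      rw [eq_div_iff (by positivity)]
      have hm : Real.exp (-w) = Real.exp (-(w / 2)) * Real.exp (-(w / 2)) := by
        rw [← Real.exp_add]; congr 1; ring
      have h1 : Real.exp (w / 2) * Real.exp (-(w / 2)) = 1 := by
        rw [← Real.exp_add]; simp
      rw [hm]
      generalize Real.cosh (2 * Real.sqrt 2 * y) = C at *
      generalize Real.exp (w / 2) = e at *
      generalize Real.exp (-(w / 2)) = f at *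
      generalize Real.sqrt 2 = q at *
      generalize Real.cos (2 * x) = c at *
      linear_combination (-2 * q * f) * hw + (q * c - C) * h1 - (C * f * (e + f) / 2) * hq2
    have hexp2 : Real.exp (-2 * w) =
            ((Real.sqrt 2 * Real.cos (2 * x) - Real.cosh (2 * Real.sqrt 2 * y)) /
              (Real.sqrt 2 * Real.cos (2 * x) + Real.cosh (2 * Real.sqrt 2 * y))) ^ 2 := by
      rw [← hexp, ← Real.exp_nat_mul]
      congr 1
      push_cast
      ring
    refine ⟨hexp2, ?_⟩
    have hpos : 0 < Real.sqrt 2 * Real.cos (2 * x) + Real.cosh (2 * Real.sqrt 2 * y) := by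
      positivity
    have hne : ((Real.sqrt 2 * Real.cos (2 * x) + Real.cosh (2 * Real.sqrt 2 * y) : ℝ) : ℂ) ≠ 0 := by
      exact_mod_cast hpos.ne'
    have hcast := congrArg (fun r : ℝ => (r : ℂ)) hexp2
    simp only [Complex.ofReal_pow, Complex.ofReal_div] at hcast
    rw [hcast, div_pow, div_mul_eq_mul_div, eq_div_iff (pow_ne_zero 2 hne), ← key2]
    ring

end
end

section
/- Let w, θ : ℝ² → ℝ be smooth functions satisfying the Bäcklund system (BT), and set W = tanh(w/2) and Θ = tan(θ/2). Then at every point (x,y) where cos(θ(x,y)/2) ≠ 0, one has ∂_x W · (1 + Θ²) − ∂_y Θ · (1 − W²) = −4WΘ and ∂_y W · (1 + Θ²) + ∂_x Θ · (1 − W²) = −(1 + W²)(1 − Θ²). -/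
open Real intervalIntegral

noncomputable section

theorem aux_tanh (f : ℝ → ℝ) (x : ℝ) (hf : DifferentiableAt ℝ f x) :
    deriv (fun t => Real.tanh (f t / 2)) x = deriv f x / 2 / Real.cosh (f x / 2) ^ 2 := by
  have h := hf.hasDerivAt.div_const 2
  have hC := (Real.cosh_pos (f x / 2)).ne'
  have h2 := (h.sinh).div h.cosh hC
  have e : (fun t => Real.tanh (f t / 2)) =
      (fun t => Real.sinh (f t / 2)) / (fun t => Real.cosh (f t / 2)) := by
    funext t
    simp [Real.tanh_eq_sinh_div_cosh]
  rw [e, h2.deriv]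
  congr 1
  linear_combination (deriv f x / 2) * Real.cosh_sq_sub_sinh_sq (f x / 2)

theorem aux_tan (f : ℝ → ℝ) (x : ℝ) (hf : DifferentiableAt ℝ f x)
    (hc : Real.cos (f x / 2) ≠ 0) :
    deriv (fun t => Real.tan (f t / 2)) x = deriv f x / 2 / Real.cos (f x / 2) ^ 2 := by
  have h := hf.hasDerivAt.div_const 2
  have h2 := (Real.hasDerivAt_tan hc).comp x h
  have h3 := h2.deriv
  simp only [Function.comp_def] at h3
  rw [h3]
  ring

theorem stmt_13
    (w θ : ℝ → ℝ → ℝ)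
    (hw : ContDiff ℝ (⊤ : ℕ∞) (Function.uncurry w)) (hθ : ContDiff ℝ (⊤ : ℕ∞) (Function.uncurry θ))
    (hBT1 : ∀ x y, pdx w x y - pdy θ x y = -2 * Real.sinh (w x y) * Real.sin (θ x y))
    (hBT2 : ∀ x y, pdy w x y + pdx θ x y = -2 * Real.cosh (w x y) * Real.cos (θ x y))
    (W Θ : ℝ → ℝ → ℝ)
    (hW : ∀ x y, W x y = Real.tanh (w x y / 2))
    (hΘ : ∀ x y, Θ x y = Real.tan (θ x y / 2)) :
    ∀ x y, Real.cos (θ x y / 2) ≠ 0 →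
      pdx W x y * (1 + Θ x y ^ 2) - pdy Θ x y * (1 - W x y ^ 2) =
        -4 * W x y * Θ x y ∧
      pdy W x y * (1 + Θ x y ^ 2) + pdx Θ x y * (1 - W x y ^ 2) =
        -((1 + W x y ^ 2) * (1 - Θ x y ^ 2)) := by
  intro x y hc
  have hwd := hw.differentiable (by simp)
  have hθd := hθ.differentiable (by simp)
  have hw1 : DifferentiableAt ℝ (fun t => w t y) x :=
    (hwd (x, y)).comp x (f := fun t : ℝ => (t, y)) (by fun_prop)
  have hw2 : DifferentiableAt ℝ (fun t => w x t) y :=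
    (hwd (x, y)).comp y (f := fun t : ℝ => (x, t)) (by fun_prop)
  have hθ1 : DifferentiableAt ℝ (fun t => θ t y) x :=
    (hθd (x, y)).comp x (f := fun t : ℝ => (t, y)) (by fun_prop)
  have hθ2 : DifferentiableAt ℝ (fun t => θ x t) y :=
    (hθd (x, y)).comp y (f := fun t : ℝ => (x, t)) (by fun_prop)
  have b1 := hBT1 x y
  have b2 := hBT2 x y
  have eW1 : pdx W x y = pdx w x y / 2 / Real.cosh (w x y / 2) ^ 2 := by
    simp only [pdx, hW]
    exact aux_tanh _ x hw1
  have eW2 : pdy W x y = pdy w x y / 2 / Real.cosh (w x y / 2) ^ 2 := by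
    simp only [pdy, hW]
    exact aux_tanh _ y hw2
  have eT1 : pdx Θ x y = pdx θ x y / 2 / Real.cos (θ x y / 2) ^ 2 := by
    simp only [pdx, hΘ]
    exact aux_tan _ x hθ1 hc
  have eT2 : pdy Θ x y = pdy θ x y / 2 / Real.cos (θ x y / 2) ^ 2 := by
    simp only [pdy, hΘ]
    exact aux_tan _ y hθ2 hc
  have hC := (Real.cosh_pos (w x y / 2)).ne'
  have s1 : Real.sinh (w x y) = 2 * Real.sinh (w x y / 2) * Real.cosh (w x y / 2) := by
    rw [← Real.sinh_two_mul]; ring_nf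
  have s2 : Real.cosh (w x y) = Real.cosh (w x y / 2) ^ 2 + Real.sinh (w x y / 2) ^ 2 := by
    rw [← Real.cosh_two_mul]; ring_nf
  have s3 : Real.sin (θ x y) = 2 * Real.sin (θ x y / 2) * Real.cos (θ x y / 2) := by
    rw [← Real.sin_two_mul]; ring_nf
  have s4 : Real.cos (θ x y) = Real.cos (θ x y / 2) ^ 2 - Real.sin (θ x y / 2) ^ 2 := by
    rw [← Real.cos_two_mul']; ring_nf
  rw [s1, s3] at b1
  rw [s2, s4] at b2
  have k1 := Real.cosh_sq_sub_sinh_sq (w x y / 2)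
  have k2 := Real.sin_sq_add_cos_sq (θ x y / 2)
  rw [eW1, eW2, eT1, eT2, hW, hΘ, Real.tanh_eq_sinh_div_cosh, Real.tan_eq_sin_div_cos]
  generalize Real.cosh (w x y / 2) = C at *
  generalize Real.sinh (w x y / 2) = S at *
  generalize Real.cos (θ x y / 2) = c at *
  generalize Real.sin (θ x y / 2) = s at *
  have m1 : 1 + (s / c) ^ 2 = 1 / c ^ 2 := by
    field_simp; linarith
  have m2 : 1 - (S / C) ^ 2 = 1 / C ^ 2 := by
    field_simp; linarith
  rw [m1, m2]
  constructor
  · field_simp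
    linear_combination b1
  · field_simp
    linear_combination b2
end
end

section
/- Let F, G : ℝ → ℝ be differentiable and nowhere zero, with F(x)G(y) ∈ (−1,1) for all x, y, and let w(x,y) = 2 arctanh(F(x)G(y)). Then at every point of ℝ², ∂²_{xy} w = ∂_x w · ∂_y w · coth(w), where coth(w) = cosh(w)/sinh(w) (note w never vanishes since F and G are nowhere zero). -/
open Real intervalIntegral

noncomputable section

/-- The inverse hyperbolic tangent, defined on (−1, 1). -/
def arctanh (x : ℝ) : ℝ := (1/2) * Real.log ((1 + x) / (1 - x))

theorem arctanh_hasDeriv_aux (f : ℝ → ℝ) (f' x : ℝ) (hf : HasDerivAt f f' x)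
    (h : f x ∈ Set.Ioo (-1 : ℝ) 1) :
    HasDerivAt (fun t => 2 * arctanh (f t)) (2 * f' / (1 - f x ^ 2)) x := by
  obtain ⟨h1, h2⟩ := h
  have a : 1 + f x ≠ 0 := by linarith
  have b : 1 - f x ≠ 0 := by linarith
  have c : 1 - f x ^ 2 ≠ 0 := by
    have : 1 - f x ^ 2 = (1 + f x) * (1 - f x) := by ring
    rw [this]; exact mul_ne_zero a b
  have hd := ((((hf.const_add 1).fun_div (hf.const_sub 1) b).log
    (div_ne_zero a b)).const_mul (1/2 : ℝ)).const_mul (2 : ℝ)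
  unfold arctanh
  refine hd.congr_deriv ?_
  have e : 1 - f x ^ 2 = (1 + f x) * (1 - f x) := by ring
  rw [e]
  field_simp
  ring

theorem coth_aux (p : ℝ) (h : p ∈ Set.Ioo (-1 : ℝ) 1) (h0 : p ≠ 0) :
    Real.cosh (2 * arctanh p) / Real.sinh (2 * arctanh p) = (1 + p ^ 2) / (2 * p) := by
  obtain ⟨h1, h2⟩ := h
  have a : 0 < 1 + p := by linarith
  have b : 0 < 1 - p := by linarith
  have e : 2 * arctanh p = Real.log ((1 + p) / (1 - p)) := by unfold arctanh; ring
  have s : Real.sinh (2 * arctanh p) = 2 * p / ((1 + p) * (1 - p)) := by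
    rw [e, Real.sinh_eq, Real.exp_neg, Real.exp_log (div_pos a b)]
    field_simp
    ring
  have c : Real.cosh (2 * arctanh p) = (1 + p ^ 2) / ((1 + p) * (1 - p)) := by
    rw [e, Real.cosh_eq, Real.exp_neg, Real.exp_log (div_pos a b)]
    field_simp
    ring
  rw [s, c]
  field_simp

theorem stmt_14
    (F G : ℝ → ℝ) (hF : Differentiable ℝ F) (hG : Differentiable ℝ G)
    (hF0 : ∀ x, F x ≠ 0) (hG0 : ∀ y, G y ≠ 0)
    (hFG : ∀ x y, F x * G y ∈ Set.Ioo (-1 : ℝ) 1)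
    (w : ℝ → ℝ → ℝ) (hwdef : ∀ x y, w x y = 2 * arctanh (F x * G y)) :
    ∀ x y, deriv (fun s => pdx w x s) y =
      pdx w x y * pdy w x y * (Real.cosh (w x y) / Real.sinh (w x y)) := by
  intro x y
  have hx : ∀ s, pdx w x s = 2 * (deriv F x * G s) / (1 - (F x * G s) ^ 2) := by
    intro s
    unfold pdx
    simp only [hwdef]
    exact (arctanh_hasDeriv_aux (fun t => F t * G s) _ x
      ((hF x).hasDerivAt.mul_const (G s)) (hFG x s)).deriv
  have hy : pdy w x y = 2 * (F x * deriv G y) / (1 - (F x * G y) ^ 2) := by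
    unfold pdy
    simp only [hwdef]
    exact (arctanh_hasDeriv_aux (fun t => F x * G t) _ y
      ((hG y).hasDerivAt.const_mul (F x)) (hFG x y)).deriv
  have hc : 1 - (F x * G y) ^ 2 ≠ 0 := by
    obtain ⟨h1, h2⟩ := hFG x y
    nlinarith
  have hg := (hG y).hasDerivAt
  have hd := ((hg.const_mul (deriv F x)).const_mul 2).fun_div
    (((hg.const_mul (F x)).fun_pow 2).const_sub 1) hc
  have h0 := hF0 x
  have h0' := hG0 y
  rw [funext hx, hd.deriv, hy, hwdef, coth_aux _ (hFG x y) (mul_ne_zero h0 h0')]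
  beta_reduce
  clear hd hx hy
  generalize hD : 1 - (F x * G y) ^ 2 = D at *
  field_simp
  subst hD
  norm_num
  left
  ring

end
end

section
/- Let F : ℝ → ℝ be differentiable and nowhere zero, G : ℝ → ℝ differentiable, with F(x)G(y) ∈ (−1,1) for all x, y, and let w(x,y) = 2 arctanh(F(x)G(y)). If θ : ℝ² → ℝ is such that the pair (w, θ) satisfies the Bäcklund system (BT), then ∂_x w(x,y) = (F′(x)/F(x)) sinh(w(x,y)) and ∂_y θ(x,y) = 2 sinh(w(x,y)) ( sin θ(x,y) + F′(x)/(2F(x)) ) for all (x,y). -/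
open Real intervalIntegral

noncomputable section

theorem stmt_15
    (F G : ℝ → ℝ) (hF : Differentiable ℝ F) (hG : Differentiable ℝ G)
    (hF0 : ∀ x, F x ≠ 0)
    (hFG : ∀ x y, F x * G y ∈ Set.Ioo (-1 : ℝ) 1)
    (w : ℝ → ℝ → ℝ) (hwdef : ∀ x y, w x y = 2 * arctanh (F x * G y))
    (θ : ℝ → ℝ → ℝ)
    (hBT1 : ∀ x y, pdx w x y - pdy θ x y = -2 * Real.sinh (w x y) * Real.sin (θ x y))
    (hBT2 : ∀ x y, pdy w x y + pdx θ x y = -2 * Real.cosh (w x y) * Real.cos (θ x y)) :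
    ∀ x y, pdx w x y = (deriv F x / F x) * Real.sinh (w x y) ∧
      pdy θ x y = 2 * Real.sinh (w x y) *
        (Real.sin (θ x y) + deriv F x / (2 * F x)) := by
  intro x y
  have key : pdx w x y = (deriv F x / F x) * Real.sinh (w x y) := by
    obtain ⟨h1, h2⟩ := hFG x y
    have hp : 0 < 1 + F x * G y := by linarith
    have hm : 0 < 1 - F x * G y := by linarith
    have hw : ∀ t, w t y = Real.log ((1 + F t * G y) / (1 - F t * G y)) := by
      intro t
      rw [hwdef, arctanh]
      ring
    have hs : HasDerivAt (fun t => F t * G y) (deriv F x * G y) x :=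
      (hF x).hasDerivAt.mul_const (G y)
    have hd := ((hs.const_add 1).div (hs.const_sub 1) hm.ne').log (div_pos hp hm).ne'
    have hfun : (fun t => w t y) =
        fun t => Real.log ((1 + F t * G y) / (1 - F t * G y)) := funext hw
    have hpd := hd.deriv
    simp only [Pi.div_apply] at hpd
    rw [← hfun] at hpd
    unfold pdx
    rw [hpd, hw, Real.sinh_eq, Real.exp_neg, Real.exp_log (div_pos hp hm)]
    have h0 := hF0 x
    have hp' := hp.ne'
    have hm' := hm.ne'
    field_simp
    ring
  refine ⟨key, ?_⟩
  have h := hBT1 x y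
  have h0 := hF0 x
  have e : pdy θ x y = pdx w x y + 2 * Real.sinh (w x y) * Real.sin (θ x y) := by linarith
  rw [e, key]
  field_simp
  ring

end
end

section
/- Let w, θ : ℝ² → ℝ be smooth functions satisfying the Bäcklund system (BT), with ∂_y w(x,0) = 0 for all x ∈ ℝ and θ(0,0) = π/2. Then θ(x,0) = π/2 for all x ∈ ℝ. -/
open Real intervalIntegral

noncomputable section

theorem stmt_16
    (w θ : ℝ → ℝ → ℝ)
    (hw : ContDiff ℝ (⊤ : ℕ∞) (Function.uncurry w)) (hθ : ContDiff ℝ (⊤ : ℕ∞) (Function.uncurry θ))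
    (hBT1 : ∀ x y, pdx w x y - pdy θ x y = -2 * Real.sinh (w x y) * Real.sin (θ x y))
    (hBT2 : ∀ x y, pdy w x y + pdx θ x y = -2 * Real.cosh (w x y) * Real.cos (θ x y))
    (hwy0 : ∀ x, pdy w x 0 = 0) (hθ00 : θ 0 0 = Real.pi / 2) :
    ∀ x, θ x 0 = Real.pi / 2 := by
  intro x
  have hcw : Continuous fun t => -2 * Real.cosh (w t 0) := by
    have h1 : Continuous fun t : ℝ => Function.uncurry w (t, 0) :=
      hw.continuous.comp (by fun_prop)
    exact continuous_const.mul (Real.continuous_cosh.comp h1)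
  have hdθ : Differentiable ℝ fun t => θ t 0 := by
    have h1 : Differentiable ℝ (Function.uncurry θ) := hθ.differentiable (by simp)
    have h2 : Differentiable ℝ fun t : ℝ => ((t, 0) : ℝ × ℝ) := by fun_prop
    exact h1.comp h2
  obtain ⟨C, hC⟩ := (isCompact_Icc (a := -(|x| + 1)) (b := |x| + 1)).exists_bound_of_continuousOn
    hcw.continuousOn
  have key := ODE_solution_unique_of_mem_Ioo (a := -(|x| + 1)) (b := |x| + 1) (t₀ := 0)
    (K := C.toNNReal) (s := fun _ => Set.univ)
    (v := fun t p => -2 * Real.cosh (w t 0) * Real.cos p)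
    (f := fun t => θ t 0) (g := fun _ => Real.pi / 2) ?_ ?_ ?_ ?_ hθ00
  · exact key ⟨by linarith [neg_abs_le x], by linarith [le_abs_self x]⟩
  · intro t ht
    refine LipschitzOnWith.of_dist_le_mul fun p _ q _ => ?_
    have h1 := hC t ⟨ht.1.le, ht.2.le⟩
    rw [Real.dist_eq, Real.dist_eq, ← mul_sub, abs_mul]
    exact mul_le_mul (h1.trans (Real.le_coe_toNNReal C)) (Real.abs_cos_sub_cos_le p q)
      (abs_nonneg _) (NNReal.coe_nonneg _)
  · exact ⟨by linarith [abs_nonneg x], by linarith [abs_nonneg x]⟩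
  · intro t _
    refine ⟨?_, trivial⟩
    have h1 := hBT2 t 0
    rw [hwy0, zero_add] at h1
    show HasDerivAt _ (-2 * Real.cosh (w t 0) * Real.cos (θ t 0)) t
    rw [← h1]
    exact (hdθ t).hasDerivAt
  · intro t _
    refine ⟨?_, trivial⟩
    simpa using hasDerivAt_const t (Real.pi / 2)

end
end

section
/- Let θ : ℝ → ℝ be twice differentiable with θ″(x) = −2 sin(2θ(x)) for all x. Set a = 2 cos θ(0) + θ′(0), b = 2 cos θ(0) − θ′(0), and I(x) = ∫₀ˣ sin θ(s) ds. Then for all x ∈ ℝ: θ′(x) + 2 cos θ(x) = a · e^{−2I(x)} and 2 cos θ(x) − θ′(x) = b · e^{2I(x)}. -/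
open Real intervalIntegral

noncomputable section

theorem stmt_17
    (θ : ℝ → ℝ) (hθ : Differentiable ℝ θ) (hθ' : Differentiable ℝ (deriv θ))
    (hsG : ∀ x, deriv (deriv θ) x = -2 * Real.sin (2 * θ x))
    (a b : ℝ)
    (ha : a = 2 * Real.cos (θ 0) + deriv θ 0) (hb : b = 2 * Real.cos (θ 0) - deriv θ 0)
    (I : ℝ → ℝ) (hI : ∀ x, I x = ∫ s in (0:ℝ)..x, Real.sin (θ s)) :
    ∀ x, deriv θ x + 2 * Real.cos (θ x) = a * Real.exp (-2 * I x) ∧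
      2 * Real.cos (θ x) - deriv θ x = b * Real.exp (2 * I x) := by
  have hId : ∀ x, HasDerivAt I (Real.sin (θ x)) x := by
    intro x
    have hc : Continuous (fun s => Real.sin (θ s)) := Real.continuous_sin.comp hθ.continuous
    have h := intervalIntegral.integral_hasDerivAt_right (hc.intervalIntegrable 0 x)
      (hc.stronglyMeasurableAtFilter _ _) hc.continuousAt
    have e : I = fun x => ∫ s in (0:ℝ)..x, Real.sin (θ s) := funext hI
    rw [e]
    exact h
  have hI0 : I 0 = 0 := by simp [hI]
  have key : ∀ c : ℝ, c * c = 1 → ∀ x,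
      (2 * Real.cos (θ x) + c * deriv θ x) * Real.exp (c * 2 * I x)
        = 2 * Real.cos (θ 0) + c * deriv θ 0 := by
    intro c hc x
    have hd : ∀ x, HasDerivAt (fun x => (2 * Real.cos (θ x) + c * deriv θ x)
        * Real.exp (c * 2 * I x)) 0 x := by
      intro x
      have h1 := ((hθ x).hasDerivAt.cos.const_mul 2).add ((hθ' x).hasDerivAt.const_mul c)
      have h2 := ((hId x).const_mul (c * 2)).exp
      have h3 := h1.mul h2
      refine h3.congr_deriv ?_
      simp only [Pi.add_apply]
      rw [hsG, Real.sin_two_mul]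
      linear_combination (2 * Real.sin (θ x) * deriv θ x * Real.exp (c * 2 * I x)) * hc
    have := is_const_of_deriv_eq_zero (fun x => (hd x).differentiableAt)
      (fun x => (hd x).deriv) x 0
    simpa [hI0] using this
  intro x
  have k1 := key 1 (by norm_num) x
  have k2 := key (-1) (by norm_num) x
  have e1 : Real.exp (1 * 2 * I x) * Real.exp (-2 * I x) = 1 := by
    rw [← Real.exp_add, Real.exp_eq_one_iff]; ring
  have e2 : Real.exp (-1 * 2 * I x) * Real.exp (2 * I x) = 1 := by
    rw [← Real.exp_add, Real.exp_eq_one_iff]; ring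
  constructor
  · rw [ha]
    linear_combination Real.exp (-2 * I x) * k1 - (2 * Real.cos (θ x) + deriv θ x) * e1
  · rw [hb]
    linear_combination Real.exp (2 * I x) * k2 - (2 * Real.cos (θ x) - deriv θ x) * e2

end
end

section
/- Let w, θ : ℝ² → ℝ be smooth functions satisfying the Bäcklund system (BT). Then at every point of ℝ², ∂_y(cosh(w) sin(θ)) = ∂_x(sinh(w) cos(θ)). Moreover, if S : ℝ² → ℝ is a differentiable function with ∂_x S = 2S cosh(w) sin(θ) and ∂_y S = 2S sinh(w) cos(θ), then also ∂_y(S cosh(w) cos(θ)) = −∂_x(S sinh(w) sin(θ)) at every point. -/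
open Real intervalIntegral

noncomputable section

theorem stmt_18
    (w θ : ℝ → ℝ → ℝ)
    (hw : ContDiff ℝ (⊤ : ℕ∞) (Function.uncurry w)) (hθ : ContDiff ℝ (⊤ : ℕ∞) (Function.uncurry θ))
    (hBT1 : ∀ x y, pdx w x y - pdy θ x y = -2 * Real.sinh (w x y) * Real.sin (θ x y))
    (hBT2 : ∀ x y, pdy w x y + pdx θ x y = -2 * Real.cosh (w x y) * Real.cos (θ x y)) :
    (∀ x y, pdy (fun p q => Real.cosh (w p q) * Real.sin (θ p q)) x y =
      pdx (fun p q => Real.sinh (w p q) * Real.cos (θ p q)) x y) ∧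
    (∀ S : ℝ → ℝ → ℝ, Differentiable ℝ (Function.uncurry S) →
      (∀ x y, pdx S x y = 2 * S x y * Real.cosh (w x y) * Real.sin (θ x y)) →
      (∀ x y, pdy S x y = 2 * S x y * Real.sinh (w x y) * Real.cos (θ x y)) →
      ∀ x y, pdy (fun p q => S p q * Real.cosh (w p q) * Real.cos (θ p q)) x y =
        -pdx (fun p q => S p q * Real.sinh (w p q) * Real.sin (θ p q)) x y) := by
  have hX : ∀ f : ℝ → ℝ → ℝ, Differentiable ℝ (Function.uncurry f) → ∀ x y,
      HasDerivAt (fun t => f t y) (pdx f x y) x := by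
    intro f hf x y
    have h : DifferentiableAt ℝ (fun t : ℝ => Function.uncurry f (t, y)) x := by
      have h2 : DifferentiableAt ℝ (fun t : ℝ => (t, y)) x := by fun_prop
      exact DifferentiableAt.comp x (hf (x, y)) h2
    exact h.hasDerivAt
  have hY : ∀ f : ℝ → ℝ → ℝ, Differentiable ℝ (Function.uncurry f) → ∀ x y,
      HasDerivAt (fun t => f x t) (pdy f x y) y := by
    intro f hf x y
    have h : DifferentiableAt ℝ (fun t : ℝ => Function.uncurry f (x, t)) y := by
      have h2 : DifferentiableAt ℝ (fun t : ℝ => (x, t)) y := by fun_prop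
      exact DifferentiableAt.comp y (hf (x, y)) h2
    exact h.hasDerivAt
  have dw : Differentiable ℝ (Function.uncurry w) := hw.differentiable (by simp)
  have dθ : Differentiable ℝ (Function.uncurry θ) := hθ.differentiable (by simp)
  refine ⟨fun x y => ?_, fun S hS hSx hSy x y => ?_⟩
  · have e1 := ((hY w dw x y).cosh.mul (hY θ dθ x y).sin).deriv
    have e2 := ((hX w dw x y).sinh.mul (hX θ dθ x y).cos).deriv
    refine Eq.trans e1 (Eq.trans ?_ e2.symm)
    linear_combination (Real.sinh (w x y) * Real.sin (θ x y)) * hBT2 x y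
      - (Real.cosh (w x y) * Real.cos (θ x y)) * hBT1 x y
  · have e1 := (((hY S hS x y).mul (hY w dw x y).cosh).mul (hY θ dθ x y).cos).deriv
    have e2 := (((hX S hS x y).mul (hX w dw x y).sinh).mul (hX θ dθ x y).sin).deriv
    refine Eq.trans e1 (Eq.trans ?_ (congrArg Neg.neg e2.symm))
    simp only [Pi.mul_apply]
    linear_combination (S x y * Real.sinh (w x y) * Real.cos (θ x y)) * hBT2 x y
      + (S x y * Real.cosh (w x y) * Real.sin (θ x y)) * hBT1 x y
      + (Real.cosh (w x y) * Real.cos (θ x y)) * hSy x y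
      + (Real.sinh (w x y) * Real.sin (θ x y)) * hSx x y

end
end
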